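/- Let A be a complete finitely ambiguous NBW with a fixed enumeration of its states, and let m = (N, C, B) and m' = (N, C', B') be macrostates with the same first component N and with C ⊆ C'. Then L^c(m') ⊆ L^c(m). -/

import Mathlib

open scoped Classical

/-- A nondeterministic Büchi automaton on ω-words with states `Q` over alphabet `σ`. -/
structure NBW (σ : Type) (Q : Type) where
  init : Set Q
  trans : Q → σ → Set Q
  acc : Set Q

namespace NBW

variable {σ Q : Type}

/-- `ρ` is a run of `A` on the ω-word `w`. -/
def IsRun (A : NBW σ Q) (w : ℕ → σ) (ρ : ℕ → Q) : Prop :=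
  ρ 0 ∈ A.init ∧ ∀ i, ρ (i + 1) ∈ A.trans (ρ i) (w i)

/-- `ρ` is an accepting run of `A` on `w`: it visits `A.acc` infinitely often. -/
def IsAccRun (A : NBW σ Q) (w : ℕ → σ) (ρ : ℕ → Q) : Prop :=
  A.IsRun w ρ ∧ ∀ n, ∃ m, n ≤ m ∧ ρ m ∈ A.acc

/-- The ω-language accepted by `A`. -/
def Lang (A : NBW σ Q) : Set (ℕ → σ) := {w | ∃ ρ, A.IsAccRun w ρ}

/-- `A` is complete: every state has a successor on every letter. -/
def Complete (A : NBW σ Q) : Prop := ∀ q a, (A.trans q a).Nonempty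

/-- `A` is finitely ambiguous: every accepted word has finitely many accepting runs. -/
def FinitelyAmbiguous (A : NBW σ Q) : Prop :=
  ∀ w ∈ A.Lang, {ρ | A.IsAccRun w ρ}.Finite

/-- `A` is limit deterministic with partition `(QN, QD)`. -/
def LimitDetPart (A : NBW σ Q) (QN QD : Set Q) : Prop :=
  Disjoint QN QD ∧ QN ∪ QD = Set.univ ∧ A.acc ⊆ QD ∧
    ∀ q ∈ QD, ∀ a, ∃ q' ∈ QD, A.trans q a = {q'}

/-- `A` is limit deterministic (for some partition). -/
def LimitDet (A : NBW σ Q) : Prop := ∃ QN QD, A.LimitDetPart QN QD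

end NBW

namespace NBW

variable {σ Q : Type}

/-- The set of successors of the set `S` under letter `b`. -/
def dSet (A : NBW σ Q) (S : Set Q) (b : σ) : Set Q := ⋃ q ∈ S, A.trans q b

/-- The set of minimal predecessors in `S` (wrt the fixed enumeration given by the
linear order on `Q`) of the successors of `S` under letter `b`. -/
def Smin (A : NBW σ Q) [LinearOrder Q] (S : Set Q) (b : σ) : Set Q :=
  {q ∈ S | ∃ q' ∈ A.dSet S b, q' ∈ A.trans q b ∧ ∀ p ∈ S, q' ∈ A.trans p b → q ≤ p}

/-- The successor of the macrostate `(N, C, B)` under letter `b`. -/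
def macroSucc (A : NBW σ Q) [LinearOrder Q] (m : Set Q × Set Q × Set Q) (b : σ) :
    Set Q × Set Q × Set Q :=
  let M := A.Smin m.1 b
  let N' := A.dSet (m.1 ∩ M) b
  let C' := A.dSet (m.2.1 ∩ M) b ∪ (N' ∩ A.acc)
  (N', C', if m.2.2 = ∅ then C' else A.dSet (m.2.2 ∩ M) b)

/-- The sequence of macrostates obtained from `m₀` by reading the ω-word `w`. -/
def macroSeq (A : NBW σ Q) [LinearOrder Q] (m₀ : Set Q × Set Q × Set Q)
    (w : ℕ → σ) : ℕ → Set Q × Set Q × Set Q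
  | 0 => m₀
  | i + 1 => A.macroSucc (macroSeq A m₀ w i) (w i)

/-- `L^c(m₀)`: the ω-words whose macrostate sequence from `m₀` has an empty
`B`-component infinitely often. -/
def Lc (A : NBW σ Q) [LinearOrder Q] (m₀ : Set Q × Set Q × Set Q) : Set (ℕ → σ) :=
  {w | ∀ n, ∃ i, n ≤ i ∧ (macroSeq A m₀ w i).2.2 = ∅}

end NBW

theorem NBW.dSet_mono_aux {σ Q : Type} (A : NBW σ Q) {S T : Set Q} (M : Set Q) (h : S ⊆ T) (b : σ) :
    A.dSet (S ∩ M) b ⊆ A.dSet (T ∩ M) b :=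
  Set.biUnion_subset_biUnion_left (Set.inter_subset_inter_left _ h)

theorem NBW.macro_inv_aux {σ Q : Type} [LinearOrder Q] (A : NBW σ Q) (w : ℕ → σ)
    (N C B C' B' : Set Q) (hBC : B ⊆ C) (hsub : C ⊆ C') (i : ℕ) :
    (A.macroSeq (N, C, B) w i).1 = (A.macroSeq (N, C', B') w i).1 ∧
    (A.macroSeq (N, C, B) w i).2.1 ⊆ (A.macroSeq (N, C', B') w i).2.1 ∧
    (A.macroSeq (N, C, B) w i).2.2 ⊆ (A.macroSeq (N, C, B) w i).2.1 := by
  induction i with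
  | zero => exact ⟨rfl, hsub, hBC⟩
  | succ k ih =>
    obtain ⟨h1, h2, h3⟩ := ih
    simp only [NBW.macroSeq, NBW.macroSucc]
    refine ⟨by rw [h1], ?_, ?_⟩
    · rw [h1]
      exact Set.union_subset_union_left _ (A.dSet_mono_aux _ h2 _)
    · split_ifs
      · exact subset_rfl
      · exact (A.dSet_mono_aux _ h3 _).trans Set.subset_union_left

/-- Subsumption between macrostates with the same `N`-component: if `C ⊆ C'`
then `L^c(N, C', B') ⊆ L^c(N, C, B)`. -/
theorem NBW.macrostate_subsumption (σ Q : Type) [Fintype σ] [Nonempty σ]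
    [Fintype Q] [LinearOrder Q] (A : NBW σ Q)
    (hc : A.Complete) (hfa : A.FinitelyAmbiguous)
    (N C B C' B' : Set Q)
    (hBC : B ⊆ C) (hCN : C ⊆ N) (hBC' : B' ⊆ C') (hCN' : C' ⊆ N)
    (hsub : C ⊆ C') :
    A.Lc (N, C', B') ⊆ A.Lc (N, C, B) := by
  intro w hw n
  by_contra hcon
  push Not at hcon
  have inv := A.macro_inv_aux w N C B C' B' hBC hsub
  obtain ⟨i, hni, hi⟩ := hw n
  have key : ∀ k, i + 1 ≤ k →
      (A.macroSeq (N, C, B) w k).2.2 ⊆ (A.macroSeq (N, C', B') w k).2.2 := by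
    have step0 : ∀ k, (A.macroSeq (N, C', B') w k).2.2 = ∅ →
        (A.macroSeq (N, C, B) w (k + 1)).2.2 ⊆ (A.macroSeq (N, C', B') w (k + 1)).2.2 := by
      intro k hk
      have e : (A.macroSeq (N, C', B') w (k + 1)).2.2
          = (A.macroSeq (N, C', B') w (k + 1)).2.1 := by
        simp only [NBW.macroSeq, NBW.macroSucc, if_pos hk]
      rw [e]
      exact (inv (k + 1)).2.2.trans (inv (k + 1)).2.1
    intro k hk
    induction k, hk using Nat.le_induction with
    | base => exact step0 i hi
    | succ k hk ih =>
      by_cases h : (A.macroSeq (N, C', B') w k).2.2 = ∅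
      · exact step0 k h
      · have h' : (A.macroSeq (N, C, B) w k).2.2 ≠ ∅ := by
          have := hcon k (by omega)
          first | exact this | exact this.ne_empty
        simp only [NBW.macroSeq, NBW.macroSucc, if_neg h, if_neg h', (inv k).1]
        exact A.dSet_mono_aux _ ih _
  obtain ⟨j, hij, hj⟩ := hw (i + 1)
  have hs := key j hij
  rw [hj] at hs
  have h' := hcon j (by omega)
  have h0 := Set.subset_empty_iff.mp hs
  simp [h0] at h'
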